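/- Let N and d be positive integers with Nd ≥ 2, let μ be the Haar probability measure on U(Nd) acting on ℂ^N ⊗ ℂ^d, and let |0_d⟩ be a fixed unit vector in ℂ^d. For a linear operator R on ℂ^N ⊗ ℂ^N, define the doubled MPS channel ℰ⁽²⁾(R) := ∫_{U(Nd)} Tr_{d×d}( (U⊗U) (R ⊗ |0_d,0_d⟩⟨0_d,0_d|) (U†⊗U†) ) dμ(U), where the two auxiliary ℂ^d factors are attached one to each ℂ^N factor, the same unitary U acts on each copy of ℂ^N ⊗ ℂ^d, and Tr_{d×d} traces out both auxiliary factors. Then ℰ⁽²⁾(R) = (1/(N(Nd+1))) · [ (d+1)P₊ + (d−1)P₋ ] · Tr(P₊ R) + (1/(N(Nd−1))) · [ (d−1)P₊ + (d+1)P₋ ] · Tr(P₋ R), where Swap is the operator on ℂ^N ⊗ ℂ^N with Swap(|i⟩⊗|j⟩) = |j⟩⊗|i⟩ and P± = (1 ± Swap)/2. -/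

import Mathlib

open Matrix MeasureTheory
open scoped Kronecker

noncomputable instance (n : Type*) [Fintype n] [DecidableEq n] :
    MeasurableSpace (Matrix.unitaryGroup n ℂ) := borel _

instance (n : Type*) [Fintype n] [DecidableEq n] :
    BorelSpace (Matrix.unitaryGroup n ℂ) := ⟨rfl⟩

/-- The swap operator on `ℂ^N ⊗ ℂ^N`. -/
def swapOp (N : ℕ) : Matrix (Fin N × Fin N) (Fin N × Fin N) ℂ :=
  fun p q => if p.1 = q.2 ∧ p.2 = q.1 then 1 else 0

/-- Projector onto the symmetric subspace of `ℂ^N ⊗ ℂ^N`. -/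
noncomputable def Pplus (N : ℕ) : Matrix (Fin N × Fin N) (Fin N × Fin N) ℂ :=
  (1 / 2 : ℂ) • ((1 : Matrix (Fin N × Fin N) (Fin N × Fin N) ℂ) + swapOp N)

/-- Projector onto the antisymmetric subspace of `ℂ^N ⊗ ℂ^N`. -/
noncomputable def Pminus (N : ℕ) : Matrix (Fin N × Fin N) (Fin N × Fin N) ℂ :=
  (1 / 2 : ℂ) • ((1 : Matrix (Fin N × Fin N) (Fin N × Fin N) ℂ) - swapOp N)

/-- `R ⊗ |0_d,0_d⟩⟨0_d,0_d|` on `(ℂ^N ⊗ ℂ^d) ⊗ (ℂ^N ⊗ ℂ^d)`, where `R` acts on the two `ℂ^N`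
factors and the auxiliary `ℂ^d` factors are initialized in the reference state `v = |0_d⟩`. -/
def attachAux (N d : ℕ) (v : Fin d → ℂ) (R : Matrix (Fin N × Fin N) (Fin N × Fin N) ℂ) :
    Matrix ((Fin N × Fin d) × (Fin N × Fin d)) ((Fin N × Fin d) × (Fin N × Fin d)) ℂ :=
  fun p q =>
    R (p.1.1, p.2.1) (q.1.1, q.2.1) *
      (v p.1.2 * v p.2.2 * (starRingEnd ℂ) (v q.1.2) * (starRingEnd ℂ) (v q.2.2))

/-- The doubled MPS channel
`ℰ⁽²⁾(R) = ∫ Tr_{d×d} ((U⊗U) (R ⊗ |0_d,0_d⟩⟨0_d,0_d|) (U†⊗U†)) dμ(U)`. -/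
noncomputable def doubledMPSChannel (N d : ℕ)
    (μ : Measure (Matrix.unitaryGroup (Fin N × Fin d) ℂ)) (v : Fin d → ℂ)
    (R : Matrix (Fin N × Fin N) (Fin N × Fin N) ℂ) :
    Matrix (Fin N × Fin N) (Fin N × Fin N) ℂ :=
  fun p q => ∫ U, ∑ s₁ : Fin d, ∑ s₂ : Fin d,
    (((U : Matrix (Fin N × Fin d) (Fin N × Fin d) ℂ) ⊗ₖ
        (U : Matrix (Fin N × Fin d) (Fin N × Fin d) ℂ)) *
      attachAux N d v R *
      (((U : Matrix (Fin N × Fin d) (Fin N × Fin d) ℂ))ᴴ ⊗ₖ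
        ((U : Matrix (Fin N × Fin d) (Fin N × Fin d) ℂ))ᴴ))
      ((p.1, s₁), (p.2, s₂)) ((q.1, s₁), (q.2, s₂)) ∂μ

section Twirl

variable {n : Type*} [Fintype n]

/-- The conjugate `(U ⊗ U) X (U† ⊗ U†)`. -/
def conjKronecker (X : Matrix (n × n) (n × n) ℂ) (U : Matrix n n ℂ) :
    Matrix (n × n) (n × n) ℂ :=
  (U ⊗ₖ U) * X * (Uᴴ ⊗ₖ Uᴴ)

lemma conjKronecker_mul (X : Matrix (n × n) (n × n) ℂ) (V U : Matrix n n ℂ) :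
    conjKronecker X (V * U) = (V ⊗ₖ V) * conjKronecker X U * (Vᴴ ⊗ₖ Vᴴ) := by
  simp only [conjKronecker, Matrix.conjTranspose_mul, Matrix.mul_kronecker_mul, Matrix.mul_assoc]

variable [DecidableEq n]

/-- The operator on `ℂ^n ⊗ ℂ^n` exchanging the two tensor factors. -/
def swapMatrix (n : Type*) [DecidableEq n] : Matrix (n × n) (n × n) ℂ :=
  fun p q => if p.1 = q.2 ∧ p.2 = q.1 then 1 else 0

lemma swapMatrix_mul_apply (M : Matrix (n × n) (n × n) ℂ) (p q : n × n) :
    (swapMatrix n * M) p q = M p.swap q := by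
  simp [Matrix.mul_apply, swapMatrix, Fintype.sum_prod_type, ite_and, Prod.swap]

lemma mul_swapMatrix_apply (M : Matrix (n × n) (n × n) ℂ) (p q : n × n) :
    (M * swapMatrix n) p q = M p q.swap := by
  simp [Matrix.mul_apply, swapMatrix, Fintype.sum_prod_type, ite_and, Prod.swap]

lemma swapMatrix_commute_kronecker_self (V : Matrix n n ℂ) :
    Commute (swapMatrix n) (V ⊗ₖ V) := by
  ext p q
  simp [swapMatrix_mul_apply, mul_swapMatrix_apply, mul_comm]

lemma trace_swapMatrix : (swapMatrix n).trace = Fintype.card n := by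
  have : ∀ x y : n, (x = y ∧ y = x) ↔ x = y := fun x y => ⟨And.left, fun h => ⟨h, h.symm⟩⟩
  simp only [Matrix.trace, Matrix.diag_apply, swapMatrix, Fintype.sum_prod_type, this]
  simp

lemma swapMatrix_mul_self : swapMatrix n * swapMatrix n = 1 := by
  ext p q
  rw [swapMatrix_mul_apply]
  simp [swapMatrix, Matrix.one_apply, Prod.ext_iff, and_comm]

lemma permMatrix_mem_unitaryGroup (σ : Equiv.Perm n) :
    σ.permMatrix ℂ ∈ Matrix.unitaryGroup n ℂ := by
  rw [Matrix.mem_unitaryGroup_iff, Matrix.star_eq_conjTranspose, Matrix.conjTranspose_permMatrix,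
    ← Matrix.permMatrix_mul]
  simp

/-- A matrix commuting with every `V ⊗ V` is invariant under simultaneous permutation of
the basis. -/
lemma apply_perm_of_commute {M : Matrix (n × n) (n × n) ℂ}
    (hM : ∀ V ∈ Matrix.unitaryGroup n ℂ, Commute M (V ⊗ₖ V)) (σ : Equiv.Perm n) (i j k l : n) :
    M (σ i, σ j) (σ k, σ l) = M (i, j) (k, l) := by
  have h := congrFun₂ (hM _ (permMatrix_mem_unitaryGroup σ)).eq (i, j) (σ k, σ l)
  simpa [Matrix.mul_apply, Fintype.sum_prod_type, PEquiv.toMatrix_apply, ite_and] using h.symm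

lemma diagonal_mem_unitaryGroup {z : n → ℂ} (hz : ∀ i, z i * star (z i) = 1) :
    Matrix.diagonal z ∈ Matrix.unitaryGroup n ℂ := by
  rw [Matrix.mem_unitaryGroup_iff, Matrix.star_eq_conjTranspose, Matrix.diagonal_conjTranspose,
    Matrix.diagonal_mul_diagonal, ← Matrix.diagonal_one]
  congr 1
  exact funext hz

/-- A matrix commuting with every `V ⊗ V` only relates basis vectors `e_i ⊗ e_j` and
`e_k ⊗ e_l` with the same indices. -/
lemma eq_or_swap_of_commute {M : Matrix (n × n) (n × n) ℂ}
    (hM : ∀ V ∈ Matrix.unitaryGroup n ℂ, Commute M (V ⊗ₖ V)) {i j k l : n}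
    (h : M (i, j) (k, l) ≠ 0) : (k = i ∧ l = j) ∨ (k = j ∧ l = i) := by
  have key : ∀ a : n, (if k = a then Complex.I else 1) * (if l = a then Complex.I else 1)
      = (if i = a then Complex.I else 1) * (if j = a then Complex.I else 1) := by
    intro a
    have h' := congrFun₂ (hM _ (diagonal_mem_unitaryGroup
      (z := fun b => if b = a then Complex.I else 1)
      (fun b => by split_ifs <;> simp))).eq (i, j) (k, l)
    rw [Matrix.diagonal_kronecker_diagonal, Matrix.mul_diagonal, Matrix.diagonal_mul,
      mul_comm] at h'
    exact mul_right_cancel₀ h h'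
  have hI : (Complex.I : ℂ) ≠ 1 := fun h => by simpa using congrArg Complex.re h
  have hne : ∀ a b : n, (if a = b then Complex.I else 1) ≠ 0 := fun a b => by
    split_ifs <;> simp
  have hcancel : ∀ {a b : n}, Complex.I = (if a = b then Complex.I else 1) → a = b := fun h => by
    by_contra hab
    exact hI (by rwa [if_neg hab] at h)
  have hk := key k
  have hl := key l
  rw [if_pos rfl] at hk hl
  by_cases e1 : k = i
  · subst e1
    exact Or.inl ⟨rfl, (hcancel (mul_left_cancel₀ (hne k l) hl)).symm⟩
  by_cases e2 : k = j
  · subst e2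
    rw [mul_comm] at hl
    exact Or.inr ⟨rfl, (hcancel (mul_right_cancel₀ (hne k l) hl)).symm⟩
  · rw [if_neg (Ne.symm e1), if_neg (Ne.symm e2)] at hk
    have hre := congrArg Complex.re hk
    split_ifs at hre <;> norm_num at hre

/-- The reflection in the hyperplane orthogonal to the unit vector `(3 e_i + 4 e_j) / 5` is a
unitary mixing `e_i` and `e_j`. -/
lemma exists_unitary_apply_ne_zero {i j : n} (hij : i ≠ j) :
    ∃ V ∈ Matrix.unitaryGroup n ℂ, V i i ≠ 0 ∧ V i j ≠ 0 := by
  set w : n → ℂ := Pi.single i (3 / 5) + Pi.single j (4 / 5) with hw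
  have hst : star w = w := by
    ext a
    simp only [hw, Pi.star_apply, Pi.add_apply, Pi.single_apply]
    split_ifs <;> simp
  have hww : w ⬝ᵥ w = 1 := by
    simp [hw, hij, hij.symm]
    norm_num
  refine ⟨1 - (2 : ℂ) • Matrix.vecMulVec w w, ?_, ?_, ?_⟩
  · rw [Matrix.mem_unitaryGroup_iff, Matrix.star_eq_conjTranspose]
    have : Matrix.vecMulVec w w * Matrix.vecMulVec w w = Matrix.vecMulVec w w := by
      rw [Matrix.vecMulVec_mul_vecMulVec, hww, one_smul]
    simp only [Matrix.conjTranspose_sub, Matrix.conjTranspose_one, Matrix.conjTranspose_smul,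
      Matrix.conjTranspose_vecMulVec, hst, star_ofNat, sub_mul, mul_sub, one_mul, mul_one,
      Matrix.smul_mul, Matrix.mul_smul, this]
    module
  · simp [Matrix.vecMulVec_apply, hw, hij]
    norm_num
  · simp [Matrix.vecMulVec_apply, hw, hij, hij.symm]

/-- The commutant of `{V ⊗ V}` is spanned by the identity and the swap. -/
lemma exists_eq_smul_one_add_smul_swapMatrix [Nontrivial n] {M : Matrix (n × n) (n × n) ℂ}
    (hM : ∀ V ∈ Matrix.unitaryGroup n ℂ, Commute M (V ⊗ₖ V)) :
    ∃ a b : ℂ, M = a • (1 : Matrix (n × n) (n × n) ℂ) + b • swapMatrix n := by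
  obtain ⟨x, y, hxy⟩ := exists_pair_ne n
  have htrans : ∀ i j : n, i ≠ j → ∃ σ : Equiv.Perm n, σ x = i ∧ σ y = j := by
    intro i j hij
    exact MulAction.is_two_pretransitive_iff.mp
      (Equiv.Perm.isMultiplyPretransitive n 2) hxy hij
  have ha : ∀ i j, i ≠ j → M (i, j) (i, j) = M (x, y) (x, y) := by
    intro i j hij
    obtain ⟨σ, rfl, rfl⟩ := htrans i j hij
    exact apply_perm_of_commute hM σ ..
  have hb : ∀ i j, i ≠ j → M (i, j) (j, i) = M (x, y) (y, x) := by
    intro i j hij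
    obtain ⟨σ, rfl, rfl⟩ := htrans i j hij
    exact apply_perm_of_commute hM σ ..
  have hzero : ∀ i j k l, ¬ ((k = i ∧ l = j) ∨ (k = j ∧ l = i)) → M (i, j) (k, l) = 0 :=
    fun i j k l h => by
      by_contra h0
      exact h (eq_or_swap_of_commute hM h0)
  have hc : ∀ i, M (i, i) (i, i) = M (x, y) (x, y) + M (x, y) (y, x) := by
    intro i
    obtain ⟨j, hj⟩ := exists_ne i
    obtain ⟨V, hV, h1, h2⟩ := exists_unitary_apply_ne_zero hj.symm
    have h := congrFun₂ (hM V hV).eq (i, i) (i, j)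
    rw [Matrix.mul_apply, Matrix.mul_apply,
      Finset.sum_eq_single (i, i) (fun q _ hq => by
        rw [hzero i i q.1 q.2 (by simpa [Prod.ext_iff] using hq), zero_mul]) (by simp),
      Finset.sum_eq_add (i, j) (j, i) (by simp [hj.symm]) (fun q _ hq => by
        rw [hzero q.1 q.2 i j (by
          rintro (⟨h, h'⟩ | ⟨h, h'⟩)
          · exact hq.1 (Prod.ext h.symm h'.symm)
          · exact hq.2 (Prod.ext h'.symm h.symm)), mul_zero]) (by simp) (by simp)] at h
    simp only [Matrix.kronecker_apply] at h
    rw [ha i j hj.symm, hb j i hj] at h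
    refine mul_right_cancel₀ (mul_ne_zero h1 h2) (h.trans ?_)
    ring
  refine ⟨M (x, y) (x, y), M (x, y) (y, x), ?_⟩
  ext ⟨i, j⟩ ⟨k, l⟩
  by_cases h : (k = i ∧ l = j) ∨ (k = j ∧ l = i)
  · by_cases hij : i = j
    · obtain ⟨rfl, rfl⟩ : k = j ∧ l = j := by simpa [hij] using h
      subst hij
      simp [swapMatrix, hc]
    · rcases h with ⟨rfl, rfl⟩ | ⟨rfl, rfl⟩
      · simp [swapMatrix, ha _ _ hij, hij]
      · simp [swapMatrix, hb _ _ hij, Ne.symm hij, hij]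
  · rw [hzero _ _ _ _ h]
    simp only [not_or] at h
    have h1 : ¬ (i = k ∧ j = l) := fun e => h.1 ⟨e.1.symm, e.2.symm⟩
    have h2 : ¬ (i = l ∧ j = k) := fun e => h.2 ⟨e.2.symm, e.1.symm⟩
    simp [swapMatrix, h1, h2]

/-- The two-fold twirl `∫ (U ⊗ U) X (U† ⊗ U†) dμ(U)`. -/
noncomputable def twirl (μ : Measure (Matrix.unitaryGroup n ℂ)) (X : Matrix (n × n) (n × n) ℂ) :
    Matrix (n × n) (n × n) ℂ :=
  fun p q => ∫ U : Matrix.unitaryGroup n ℂ, conjKronecker X (U : Matrix n n ℂ) p q ∂μ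

lemma conjTranspose_kronecker_self_mul {U : Matrix n n ℂ} (hU : U ∈ Matrix.unitaryGroup n ℂ) :
    (Uᴴ ⊗ₖ Uᴴ) * (U ⊗ₖ U) = 1 := by
  rw [← Matrix.mul_kronecker_mul, ← Matrix.star_eq_conjTranspose,
    Matrix.mem_unitaryGroup_iff'.mp hU, Matrix.one_kronecker_one]

lemma trace_mul_conjKronecker {A : Matrix (n × n) (n × n) ℂ} {U : Matrix n n ℂ}
    (hU : U ∈ Matrix.unitaryGroup n ℂ) (hA : Commute A (U ⊗ₖ U)) (X : Matrix (n × n) (n × n) ℂ) :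
    (A * conjKronecker X U).trace = (A * X).trace := by
  rw [conjKronecker, ← Matrix.mul_assoc, ← Matrix.mul_assoc, hA.eq, Matrix.trace_mul_comm,
    Matrix.mul_assoc (U ⊗ₖ U), ← Matrix.mul_assoc, conjTranspose_kronecker_self_mul hU,
    Matrix.one_mul]

lemma integrable_conjKronecker_apply (μ : Measure (Matrix.unitaryGroup n ℂ)) [IsFiniteMeasure μ]
    (X : Matrix (n × n) (n × n) ℂ) (p q : n × n) :
    Integrable (fun U : Matrix.unitaryGroup n ℂ => conjKronecker X (U : Matrix n n ℂ) p q) μ := by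
  have hcont : ∀ i j : n, Continuous fun U : Matrix.unitaryGroup n ℂ => (U : Matrix n n ℂ) i j :=
    fun i j => (continuous_apply_apply i j).comp continuous_subtype_val
  have hbd : ∀ (U : Matrix.unitaryGroup n ℂ) (i j : n), ‖(U : Matrix n n ℂ) i j‖ ≤ 1 :=
    fun U => entry_norm_bound_of_unitary U.2
  simp only [conjKronecker, Matrix.mul_apply, Matrix.kroneckerMap_apply, Matrix.conjTranspose_apply,
    Finset.sum_mul]
  refine integrable_finsetSum _ fun r _ => integrable_finsetSum _ fun s _ => ?_
  refine Integrable.of_bound (C := ‖X s r‖) (Continuous.aestronglyMeasurable ?_)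
    (ae_of_all _ fun U => ?_)
  · exact (((hcont _ _).mul (hcont _ _)).mul continuous_const).mul
      ((hcont _ _).star.mul (hcont _ _).star)
  · simp only [norm_mul, norm_star]
    have h1 := mul_le_one₀ (hbd U p.1 s.1) (norm_nonneg _) (hbd U p.2 s.2)
    have h2 := mul_le_one₀ (hbd U q.1 r.1) (norm_nonneg _) (hbd U q.2 r.2)
    exact (mul_le_of_le_one_right (mul_nonneg (mul_nonneg (norm_nonneg _) (norm_nonneg _))
      (norm_nonneg _)) h2).trans (mul_le_of_le_one_left (norm_nonneg _) h1)

lemma trace_mul_twirl (μ : Measure (Matrix.unitaryGroup n ℂ)) [IsFiniteMeasure μ]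
    (A X : Matrix (n × n) (n × n) ℂ) :
    (A * twirl μ X).trace =
      ∫ U : Matrix.unitaryGroup n ℂ, (A * conjKronecker X (U : Matrix n n ℂ)).trace ∂μ := by
  simp only [Matrix.trace, Matrix.diag_apply, Matrix.mul_apply]
  have hint := fun p q => (integrable_conjKronecker_apply μ X q p).const_mul (A p q)
  rw [integral_finsetSum _ fun p _ => integrable_finsetSum _ fun q _ => hint p q]
  refine Finset.sum_congr rfl fun p _ => ?_
  rw [integral_finsetSum _ fun q _ => hint p q]
  exact Finset.sum_congr rfl fun q _ => (integral_const_mul _ _).symm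

lemma twirl_commute (μ : Measure (Matrix.unitaryGroup n ℂ)) [IsFiniteMeasure μ]
    [μ.IsMulLeftInvariant] (X : Matrix (n × n) (n × n) ℂ) {V : Matrix n n ℂ}
    (hV : V ∈ Matrix.unitaryGroup n ℂ) : Commute (twirl μ X) (V ⊗ₖ V) := by
  have hinv : (V ⊗ₖ V) * twirl μ X * (Vᴴ ⊗ₖ Vᴴ) = twirl μ X := by
    rw [Matrix.ext_iff_trace_mul_left]
    intro A
    have hcycle : ∀ Y : Matrix (n × n) (n × n) ℂ,
        (A * ((V ⊗ₖ V) * Y * (Vᴴ ⊗ₖ Vᴴ))).trace = ((Vᴴ ⊗ₖ Vᴴ) * A * (V ⊗ₖ V) * Y).trace := by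
      intro Y
      rw [← Matrix.mul_assoc, Matrix.trace_mul_comm]
      simp only [Matrix.mul_assoc]
    rw [hcycle, trace_mul_twirl, trace_mul_twirl]
    simp only [← hcycle, ← conjKronecker_mul]
    exact integral_mul_left_eq_self
      (fun U : Matrix.unitaryGroup n ℂ => (A * conjKronecker X (U : Matrix n n ℂ)).trace) ⟨V, hV⟩
  have h := congrArg (· * (V ⊗ₖ V)) hinv
  simp only [Matrix.mul_assoc, conjTranspose_kronecker_self_mul hV, Matrix.mul_one] at h
  exact h.symm

lemma trace_mul_twirl_of_commute (μ : Measure (Matrix.unitaryGroup n ℂ)) [IsProbabilityMeasure μ]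
    {A : Matrix (n × n) (n × n) ℂ} (hA : ∀ V : Matrix n n ℂ, Commute A (V ⊗ₖ V))
    (X : Matrix (n × n) (n × n) ℂ) : (A * twirl μ X).trace = (A * X).trace := by
  simp [trace_mul_twirl, fun U : Matrix.unitaryGroup n ℂ => trace_mul_conjKronecker U.2 (hA U) X]

/-- The two-fold twirl is a combination of the identity and the swap, whose coefficients are
determined by `Tr X` and `Tr (Swap X)`. -/
lemma exists_twirl_eq [Nontrivial n] (μ : Measure (Matrix.unitaryGroup n ℂ))
    [IsProbabilityMeasure μ] [μ.IsMulLeftInvariant] (X : Matrix (n × n) (n × n) ℂ) :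
    ∃ a b : ℂ, twirl μ X = a • (1 : Matrix (n × n) (n × n) ℂ) + b • swapMatrix n ∧
      a * (Fintype.card n : ℂ) ^ 2 + b * Fintype.card n = X.trace ∧
      a * Fintype.card n + b * (Fintype.card n : ℂ) ^ 2 = (swapMatrix n * X).trace := by
  obtain ⟨a, b, h⟩ := exists_eq_smul_one_add_smul_swapMatrix fun V hV => twirl_commute μ X hV
  refine ⟨a, b, h, ?_, ?_⟩
  · have h1 := trace_mul_twirl_of_commute μ (fun V => Commute.one_left (V ⊗ₖ V)) X
    rw [Matrix.one_mul, Matrix.one_mul, h] at h1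
    rw [← h1]
    simp [Matrix.trace_add, Matrix.trace_smul, trace_swapMatrix, Matrix.trace_one, pow_two]
  · have h1 := trace_mul_twirl_of_commute μ swapMatrix_commute_kronecker_self X
    rw [h] at h1
    rw [← h1]
    simp [mul_add, swapMatrix_mul_self, Matrix.trace_add, Matrix.trace_smul, trace_swapMatrix,
      Matrix.trace_one, pow_two]

end Twirl

lemma doubledMPSChannel_apply (N d : ℕ)
    (μ : Measure (Matrix.unitaryGroup (Fin N × Fin d) ℂ)) [IsFiniteMeasure μ] (v : Fin d → ℂ)
    (R : Matrix (Fin N × Fin N) (Fin N × Fin N) ℂ) (p q : Fin N × Fin N) :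
    doubledMPSChannel N d μ v R p q = ∑ s₁ : Fin d, ∑ s₂ : Fin d,
      twirl μ (attachAux N d v R) ((p.1, s₁), (p.2, s₂)) ((q.1, s₁), (q.2, s₂)) := by
  have hint := fun s₁ s₂ : Fin d => integrable_conjKronecker_apply μ (attachAux N d v R)
    ((p.1, s₁), (p.2, s₂)) ((q.1, s₁), (q.2, s₂))
  unfold doubledMPSChannel twirl
  simp only [conjKronecker] at hint ⊢
  rw [integral_finsetSum _ fun s₁ _ => integrable_finsetSum _ fun s₂ _ => hint s₁ s₂]
  exact Finset.sum_congr rfl fun s₁ _ => integral_finsetSum _ fun s₂ _ => hint s₁ s₂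

lemma sum_mul_conj_eq_one {d : ℕ} {v : Fin d → ℂ} (hv : ∑ s, ‖v s‖ ^ 2 = 1) :
    ∑ s, v s * (starRingEnd ℂ) (v s) = 1 := by
  simp only [Complex.mul_conj']
  exact_mod_cast hv

lemma trace_attachAux {N d : ℕ} {v : Fin d → ℂ} (hv : ∑ s, ‖v s‖ ^ 2 = 1)
    (R : Matrix (Fin N × Fin N) (Fin N × Fin N) ℂ) : (attachAux N d v R).trace = R.trace := by
  have h := sum_mul_conj_eq_one hv
  simp only [Matrix.trace, Matrix.diag_apply, attachAux, Fintype.sum_prod_type]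
  refine Finset.sum_congr rfl fun i _ => ?_
  rw [Finset.sum_comm]
  refine Finset.sum_congr rfl fun j _ => ?_
  calc _ = R (i, j) (i, j) * ((∑ s, v s * (starRingEnd ℂ) (v s)) *
        ∑ s, v s * (starRingEnd ℂ) (v s)) := by
        rw [Finset.sum_mul_sum, Finset.mul_sum]
        refine Finset.sum_congr rfl fun s _ => ?_
        rw [Finset.mul_sum]
        exact Finset.sum_congr rfl fun t _ => by ring
    _ = _ := by rw [h]; ring

lemma swapMatrix_mul_attachAux (N d : ℕ) (v : Fin d → ℂ)
    (R : Matrix (Fin N × Fin N) (Fin N × Fin N) ℂ) :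
    swapMatrix (Fin N × Fin d) * attachAux N d v R = attachAux N d v (swapOp N * R) := by
  ext p q
  rw [swapMatrix_mul_apply]
  change _ = (swapMatrix (Fin N) * R) _ _ * _
  rw [swapMatrix_mul_apply]
  simp only [attachAux, Prod.swap]
  ring

lemma sum_one_apply (N d : ℕ) (p q : Fin N × Fin N) :
    ∑ s₁ : Fin d, ∑ s₂ : Fin d,
      (1 : Matrix ((Fin N × Fin d) × (Fin N × Fin d)) ((Fin N × Fin d) × (Fin N × Fin d)) ℂ)
        ((p.1, s₁), (p.2, s₂)) ((q.1, s₁), (q.2, s₂))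
      = (d : ℂ) ^ 2 * (1 : Matrix (Fin N × Fin N) (Fin N × Fin N) ℂ) p q := by
  by_cases h : p = q
  · subst h
    simp only [Matrix.one_apply_eq]
    simp [pow_two]
  · have : ¬ (p.1 = q.1 ∧ p.2 = q.2) := fun e => h (Prod.ext e.1 e.2)
    simp [h, this]

lemma sum_swapMatrix_apply (N d : ℕ) (p q : Fin N × Fin N) :
    ∑ s₁ : Fin d, ∑ s₂ : Fin d,
      swapMatrix (Fin N × Fin d) ((p.1, s₁), (p.2, s₂)) ((q.1, s₁), (q.2, s₂))
      = (d : ℂ) * swapOp N p q := by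
  by_cases h : p.1 = q.2 ∧ p.2 = q.1
  · have : ∀ x y : Fin d, (x = y ∧ y = x) ↔ x = y := fun x y => ⟨And.left, fun h => ⟨h, h.symm⟩⟩
    simp [swapMatrix, swapOp, h, this]
  · have : ∀ s₁ s₂ : Fin d, ¬ ((p.1 = q.2 ∧ s₁ = s₂) ∧ (p.2 = q.1 ∧ s₂ = s₁)) :=
      fun _ _ e => h ⟨e.1.1, e.2.1⟩
    simp [swapMatrix, swapOp, h, this]

/-- Explicit form of the doubled MPS channel:
`ℰ⁽²⁾(R) = (1/(N(Nd+1))) [(d+1)P₊ + (d−1)P₋] Tr(P₊R) + (1/(N(Nd−1))) [(d−1)P₊ + (d+1)P₋] Tr(P₋R)`. -/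
theorem doubled_mps_channel_eq (N d : ℕ) (hN : 0 < N) (hd : 0 < d) (hNd : 2 ≤ N * d)
    (μ : Measure (Matrix.unitaryGroup (Fin N × Fin d) ℂ))
    [μ.IsHaarMeasure] [IsProbabilityMeasure μ]
    (v : Fin d → ℂ) (hv : ∑ s, ‖v s‖ ^ 2 = 1)
    (R : Matrix (Fin N × Fin N) (Fin N × Fin N) ℂ) :
    doubledMPSChannel N d μ v R
      = ((1 / ((N : ℂ) * ((N : ℂ) * (d : ℂ) + 1)) * (Pplus N * R).trace) •
          (((d : ℂ) + 1) • Pplus N + ((d : ℂ) - 1) • Pminus N))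
        + ((1 / ((N : ℂ) * ((N : ℂ) * (d : ℂ) - 1)) * (Pminus N * R).trace) •
          (((d : ℂ) - 1) • Pplus N + ((d : ℂ) + 1) • Pminus N)) := by
  have hcard : Fintype.card (Fin N × Fin d) = N * d := by simp
  have : Nontrivial (Fin N × Fin d) := by
    rw [← Fintype.one_lt_card_iff_nontrivial, hcard]
    exact hNd
  obtain ⟨a, b, hT, h1, h2⟩ := exists_twirl_eq μ (attachAux N d v R)
  rw [swapMatrix_mul_attachAux, trace_attachAux hv] at h2
  rw [trace_attachAux hv] at h1
  rw [hcard] at h1 h2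
  push_cast at h1 h2
  have hN0 : (N : ℂ) ≠ 0 := by exact_mod_cast hN.ne'
  have hp : (d : ℂ) * N + 1 ≠ 0 := by exact_mod_cast (d * N).succ_ne_zero
  have hm : (d : ℂ) * N - 1 ≠ 0 := by
    rw [sub_ne_zero, mul_comm]
    exact_mod_cast (by omega : N * d ≠ 1)
  have hplus : (Pplus N * R).trace = (R.trace + (swapOp N * R).trace) / 2 := by
    simp [Pplus, add_mul, Matrix.trace_add, Matrix.trace_smul]
    ring
  have hminus : (Pminus N * R).trace = (R.trace - (swapOp N * R).trace) / 2 := by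
    simp [Pminus, sub_mul, Matrix.trace_sub, Matrix.trace_smul]
    ring
  ext p q
  rw [doubledMPSChannel_apply, hT]
  simp only [Matrix.add_apply, Matrix.smul_apply, smul_eq_mul, Finset.sum_add_distrib,
    ← Finset.mul_sum, sum_one_apply, sum_swapMatrix_apply]
  rw [hplus, hminus, ← h1, ← h2]
  simp only [Pplus, Pminus, Matrix.add_apply, Matrix.sub_apply, Matrix.smul_apply, smul_eq_mul]
  field_simp
  ring
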